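/- arXiv:2602.23030 — 2 statements merged into one kernel-verified Lean document; each statement's English description precedes it below -/
import Mathlib

section
/- Fix a sequence (S_i)_{i≥1} of shufflers over Σ and a constant m₀ ∈ ℕ. For every L ≥ 0 and all prefixes u, v ∈ Σ^L: min over (a,b) ∈ Σ × Σ of Φ_{L+1}(ua, vb) is at most Σ_{j∈J(L+1)} B_{N_j}(u,v). -/
open MeasureTheory Filter Finset
open scoped ENNReal ProbabilityTheory

/-- A deterministic shuffler over the alphabet `Fin k`, with state set `Fin S.n`.
`τ q = true` means: read from tape 1 (the `x` tape); `τ q = false` means tape 2. -/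
structure Shuffler (k : ℕ) where
  n : ℕ
  q0 : Fin n
  δ : Fin n → Fin k → Fin n
  τ : Fin n → Bool

namespace Shuffler

variable {k : ℕ}

/-- Configuration after `t` output steps: current state, and the numbers of symbols
consumed from tape 1 and from tape 2. -/
def conf (S : Shuffler k) (x y : ℕ → Fin k) : ℕ → Fin S.n × ℕ × ℕ
  | 0 => (S.q0, 0, 0)
  | t + 1 =>
    match S.conf x y t with
    | (q, a, b) =>
      if S.τ q then (S.δ q (x a), a + 1, b) else (S.δ q (y b), a, b + 1)

/-- The shuffled output word `S(x,y) : ℕ → Fin k`. -/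
def out (S : Shuffler k) (x y : ℕ → Fin k) (t : ℕ) : Fin k :=
  match S.conf x y t with
  | (q, a, b) => if S.τ q then x a else y b

end Shuffler

/-- The length-`n` prefix of an infinite word. -/
def wpre {k : ℕ} (x : ℕ → Fin k) (n : ℕ) : List (Fin k) :=
  List.ofFn (fun i : Fin n => x i)

/-- Overlapping occurrence count of the block `w` inside the finite word `u`. -/
def occ {k : ℕ} (u w : List (Fin k)) : ℕ :=
  ((Finset.range (u.length + 1 - w.length)).filter
    (fun t => (u.drop t).take w.length = w)).card

/-- Aligned (non-overlapping) occurrence count of `w` among the consecutive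
`|w|`-blocks of `u`. -/
def alocc {k : ℕ} (u w : List (Fin k)) : ℕ :=
  ((Finset.range (u.length / w.length)).filter
    (fun j => (u.drop (j * w.length)).take w.length = w)).card

/-- Borel normality of an infinite word over `Fin k`. -/
def IsNormal {k : ℕ} (z : ℕ → Fin k) : Prop :=
  ∀ w : List (Fin k), w ≠ [] →
    Tendsto (fun n => (occ (wpre z n) w : ℝ) / (n : ℝ)) atTop
      (nhds ((1 : ℝ) / (k : ℝ) ^ w.length))

/-- The cylinder determined by a finite word. -/
def cyl {k : ℕ} (u : List (Fin k)) : Set (ℕ → Fin k) :=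
  {x | wpre x u.length = u}

/-- `ν` is the i.i.d. uniform product measure on `ℕ → Fin k`:
it gives every cylinder of a length-`n` word measure `k⁻ⁿ`. -/
def IsUniformProductMeasure {k : ℕ} (ν : Measure (ℕ → Fin k)) : Prop :=
  IsProbabilityMeasure ν ∧ ∀ u : List (Fin k), ν (cyl u) = ((k : ℝ≥0∞))⁻¹ ^ u.length

noncomputable def elln (k n : ℕ) : ℕ := ⌊Real.logb k n / 3⌋₊

noncomputable def epsn (k n : ℕ) : ℝ :=
  2 * Real.sqrt (Real.log n * Real.logb k n / n)

def mnr (n r : ℕ) : ℕ := n / r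

/-- The good event `E_S(n, r, w)` (with `r = w.length`). -/
def ESet {k : ℕ} (S : Shuffler k) (n : ℕ) (w : List (Fin k)) :
    Set ((ℕ → Fin k) × (ℕ → Fin k)) :=
  {p | |(alocc (wpre (S.out p.1 p.2) n) w : ℝ) - (mnr n w.length : ℝ) / (k : ℝ) ^ w.length|
        < epsn k n * (mnr n w.length : ℝ)}

/-- Total conditional bad mass `B_n(u,v)` for the first `n` shufflers of the sequence `S`. -/
noncomputable def Bn {k : ℕ} (μ : Measure ((ℕ → Fin k) × (ℕ → Fin k)))
    (S : ℕ → Shuffler k) (n : ℕ) (u v : List (Fin k)) : ℝ≥0∞ :=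
  ∑ i ∈ Finset.Icc 1 n, ∑ r ∈ Finset.Icc 1 (elln k n), ∑ w : Fin r → Fin k,
    ProbabilityTheory.cond μ (cyl u ×ˢ cyl v) (ESet (S i) n (List.ofFn w))ᶜ

/-- The rolling potential `Φ_L(u,v)` with checkpoints `N_j = (j+m₀)^4`
and activation lengths `A_j = (j+m₀)^2`. -/
noncomputable def Phi {k : ℕ} (μ : Measure ((ℕ → Fin k) × (ℕ → Fin k)))
    (S : ℕ → Shuffler k) (m₀ : ℕ) (L : ℕ) (u v : List (Fin k)) : ℝ≥0∞ :=
  ∑ j ∈ (Finset.Icc 1 L).filter (fun j => (j + m₀) ^ 2 ≤ L ∧ L ≤ (j + m₀) ^ 4),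
    Bn μ S ((j + m₀) ^ 4) u v

/-- `Test(u; m, ε)`: all `m`-blocks of `u` have frequency within `ε` of `k^{-m}`. -/
def TestP {k : ℕ} (u : List (Fin k)) (m : ℕ) (ε : ℝ) : Prop :=
  ∀ w : List (Fin k), w.length = m →
    |(occ u w : ℝ) / (u.length : ℝ) - (1 : ℝ) / (k : ℝ) ^ m| ≤ ε

/-- The test event `E_S(n; m, ε)`. -/
def ETest {k : ℕ} (S : Shuffler k) (n m : ℕ) (ε : ℝ) :
    Set ((ℕ → Fin k) × (ℕ → Fin k)) :=
  {p | TestP (wpre (S.out p.1 p.2) n) m ε}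

/-- The quadratic window slice `H_t(N)(x)`. -/
def Hslice {k : ℕ} (S : ℕ → Shuffler k) (t N : ℕ) (x : ℕ → Fin k) :
    Set (ℕ → Fin k) :=
  ⋂ i ∈ Finset.Icc 1 t, ⋂ ℓ ∈ Finset.Icc 1 t, ⋂ n ∈ Finset.Icc N (N ^ 2),
    {y | (x, y) ∈ ETest (S i) n ℓ ((1 : ℝ) / 2 ^ t)}

/-- A finite encoding of a shuffler, suitable for computability statements. -/
def Shuffler.encode {k : ℕ} (S : Shuffler k) : ℕ × ℕ × List ℕ × List Bool :=
  (S.n, (S.q0 : ℕ),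
    (List.finRange S.n).flatMap (fun q => (List.finRange k).map (fun a => ((S.δ q a : ℕ)))),
    (List.finRange S.n).map S.τ)

theorem mem_cyl_iff {k : ℕ} (u : List (Fin k)) (x : ℕ → Fin k) :
    x ∈ cyl u ↔ ∀ i : Fin u.length, x i = u.get i := by
  change wpre x u.length = u ↔ _
  rw [wpre]
  conv_lhs => rhs; rw [← List.ofFn_get u]
  rw [List.ofFn_inj, funext_iff]

theorem measurableSet_cyl {k : ℕ} (u : List (Fin k)) : MeasurableSet (cyl u) := by
  have h : cyl u = ⋂ i : Fin u.length, (fun x : ℕ → Fin k => x i) ⁻¹' {u.get i} := by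
    ext x
    simp only [mem_cyl_iff, Set.mem_iInter, Set.mem_preimage, Set.mem_singleton_iff]
  rw [h]
  exact MeasurableSet.iInter fun i => measurable_pi_apply _ (measurableSet_singleton _)

theorem mem_cyl_concat_iff {k : ℕ} (u : List (Fin k)) (a : Fin k) (x : ℕ → Fin k) :
    x ∈ cyl (u ++ [a]) ↔ x ∈ cyl u ∧ x u.length = a := by
  have h : wpre x (u ++ [a]).length = wpre x u.length ++ [x u.length] := by
    rw [List.length_append, List.length_singleton]
    simp only [wpre]
    rw [List.ofFn_succ_last]
    rfl
  change wpre x (u ++ [a]).length = u ++ [a] ↔ wpre x u.length = u ∧ _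
  rw [h, ← List.concat_eq_append, ← List.concat_eq_append, List.concat_inj]

theorem cyl_prod_eq_iUnion {k : ℕ} (u v : List (Fin k)) :
    cyl u ×ˢ cyl v = ⋃ p : Fin k × Fin k, cyl (u ++ [p.1]) ×ˢ cyl (v ++ [p.2]) := by
  ext ⟨x, y⟩
  simp [mem_cyl_concat_iff]

theorem pairwise_disjoint_cyl_concat_prod {k : ℕ} (u v : List (Fin k)) :
    Pairwise (Function.onFun Disjoint
      fun p : Fin k × Fin k => cyl (u ++ [p.1]) ×ˢ cyl (v ++ [p.2])) := by
  refine fun p q hpq => Set.disjoint_left.2 fun z hp hq => hpq ?_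
  simp only [Set.mem_prod, mem_cyl_concat_iff] at hp hq
  exact Prod.ext (hp.1.2.symm.trans hq.1.2) (hp.2.2.symm.trans hq.2.2)

theorem sum_measure_cyl_concat_prod_inter {k : ℕ} (μ : Measure ((ℕ → Fin k) × (ℕ → Fin k)))
    (u v : List (Fin k)) (A : Set ((ℕ → Fin k) × (ℕ → Fin k))) :
    ∑ p : Fin k × Fin k, μ (cyl (u ++ [p.1]) ×ˢ cyl (v ++ [p.2]) ∩ A)
      = μ (cyl u ×ˢ cyl v ∩ A) := by
  have hm (u v : List (Fin k)) : MeasurableSet (cyl u ×ˢ cyl v) :=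
    (measurableSet_cyl u).prod (measurableSet_cyl v)
  simp_rw [← Measure.restrict_apply (hm _ _)]
  rw [cyl_prod_eq_iUnion, measure_iUnion (pairwise_disjoint_cyl_concat_prod u v)
    fun p => hm _ _, tsum_fintype]

theorem sum_cond_cyl_concat_prod {k : ℕ} {ν : Measure (ℕ → Fin k)}
    (hν : IsUniformProductMeasure ν) (u v : List (Fin k))
    (A : Set ((ℕ → Fin k) × (ℕ → Fin k))) :
    ∑ p : Fin k × Fin k,
        ProbabilityTheory.cond (ν.prod ν) (cyl (u ++ [p.1]) ×ˢ cyl (v ++ [p.2])) A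
      = (k : ℝ≥0∞) ^ 2 * ProbabilityTheory.cond (ν.prod ν) (cyl u ×ˢ cyl v) A := by
  have := hν.1
  have hmass (u v : List (Fin k)) : ((ν.prod ν) (cyl u ×ˢ cyl v))⁻¹
      = (k : ℝ≥0∞) ^ (u.length + v.length) := by
    rw [Measure.prod_prod, hν.2, hν.2, ← pow_add, ← ENNReal.inv_pow, inv_inv]
  simp_rw [ProbabilityTheory.cond_apply
    ((measurableSet_cyl _).prod (measurableSet_cyl _)) (ν.prod ν), hmass]
  rw [← sum_measure_cyl_concat_prod_inter (ν.prod ν) u v A, ← mul_assoc, ← pow_add,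
    Finset.mul_sum]
  refine Finset.sum_congr rfl fun p _ => ?_
  congr 2
  simp only [List.length_append, List.length_singleton]
  ring

theorem sum_Bn_concat {k : ℕ} {ν : Measure (ℕ → Fin k)}
    (hν : IsUniformProductMeasure ν) (S : ℕ → Shuffler k) (n : ℕ) (u v : List (Fin k)) :
    ∑ p : Fin k × Fin k, Bn (ν.prod ν) S n (u ++ [p.1]) (v ++ [p.2])
      = (k : ℝ≥0∞) ^ 2 * Bn (ν.prod ν) S n u v := by
  simp only [Bn, Finset.mul_sum]
  rw [Finset.sum_comm]
  refine Finset.sum_congr rfl fun i _ => ?_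
  rw [Finset.sum_comm]
  refine Finset.sum_congr rfl fun r _ => ?_
  rw [Finset.sum_comm]
  exact Finset.sum_congr rfl fun w _ => sum_cond_cyl_concat_prod hν u v _

/-- the minimum of the next-step potential over all one-symbol
extensions is at most the rolling sum of the current bad masses. -/
theorem stmt_7 (k : ℕ) (hk : 2 ≤ k) (S : ℕ → Shuffler k) (m₀ : ℕ)
    (ν : Measure (ℕ → Fin k)) (hν : IsUniformProductMeasure ν)
    (L : ℕ) (u v : List (Fin k)) (hu : u.length = L) (hv : v.length = L) :
    (⨅ p : Fin k × Fin k,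
        Phi (ν.prod ν) S m₀ (L + 1) (u ++ [p.1]) (v ++ [p.2]))
      ≤ ∑ j ∈ (Finset.Icc 1 (L + 1)).filter
            (fun j => (j + m₀) ^ 2 ≤ L + 1 ∧ L + 1 ≤ (j + m₀) ^ 4),
          Bn (ν.prod ν) S ((j + m₀) ^ 4) u v := by
  have hk0 : k ≠ 0 := by omega
  have hne : (k : ℝ≥0∞) ^ 2 ≠ 0 := pow_ne_zero _ (Nat.cast_ne_zero.2 hk0)
  have hfin : (k : ℝ≥0∞) ^ 2 ≠ ∞ := ENNReal.pow_ne_top (ENNReal.natCast_ne_top k)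
  rw [← ENNReal.mul_le_mul_iff_right hne hfin]
  calc (k : ℝ≥0∞) ^ 2 * ⨅ p : Fin k × Fin k,
        Phi (ν.prod ν) S m₀ (L + 1) (u ++ [p.1]) (v ++ [p.2])
      = ∑ _p : Fin k × Fin k, ⨅ p : Fin k × Fin k,
          Phi (ν.prod ν) S m₀ (L + 1) (u ++ [p.1]) (v ++ [p.2]) := by
        simp [sq]
    _ ≤ ∑ p : Fin k × Fin k, Phi (ν.prod ν) S m₀ (L + 1) (u ++ [p.1]) (v ++ [p.2]) :=
        Finset.sum_le_sum fun p _ => iInf_le _ p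
    _ = _ := by
        simp only [Phi]
        rw [Finset.sum_comm, Finset.mul_sum]
        exact Finset.sum_congr rfl fun j _ => sum_Bn_concat hν S _ u v
end

section
/- Let (G_t)_{t≥1} be clopen subsets of Σ^∞ such that 1 − ν^∞(G_t) ≤ 2^{−2t} for each t ≥ 1. Assume the function sending a pair (L, v) ∈ ℕ × Σ^* to the exact rational number ν^∞((⋂_{t≤L} G_t) ∩ [v]) is computable. Then there exists a computable word y ∈ Σ^∞ with y ∈ ⋂_{t≥1} G_t. -/
open MeasureTheory Filter Finset
open scoped ENNReal ProbabilityTheory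

/-- The code of a rational number given by `Rat.instEncodable`, from which the code given by
`Rat.instDenumerable` is obtained by ranking. -/
def ratCode (r : ℚ) : ℕ := @Encodable.encode ℚ Rat.instEncodable r

theorem ratCode_eq (r : ℚ) : ratCode r = Nat.pair (Encodable.encode r.num) r.den := rfl

instance infinite_range_ratCode : Infinite (Set.range ratCode) :=
  Infinite.of_injective _
    (Equiv.ofInjective ratCode (@Encodable.encode_injective ℚ Rat.instEncodable)).injective

theorem ratCode_ofNat [i : DecidablePred (· ∈ Set.range ratCode)] (n : ℕ) :
    ratCode (Denumerable.ofNat ℚ n) = Nat.Subtype.ofNat (Set.range ratCode) n := by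
  obtain rfl : i = @Encodable.decidableRangeEncode ℚ Rat.instEncodable := Subsingleton.elim _ _
  let _ : DecidablePred (· ∈ Set.range (@Encodable.encode ℚ Rat.instEncodable)) :=
    @Encodable.decidableRangeEncode ℚ Rat.instEncodable
  have : Infinite (Set.range (@Encodable.encode ℚ Rat.instEncodable)) := infinite_range_ratCode
  let _ := Nat.Subtype.denumerable (Set.range (@Encodable.encode ℚ Rat.instEncodable))
  have h : Denumerable.ofNat ℚ n = (@Encodable.equivRangeEncode ℚ Rat.instEncodable).symm
      (Denumerable.ofNat (Set.range (@Encodable.encode ℚ Rat.instEncodable)) n) :=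
    Denumerable.ofEquiv_ofNat (Set.range _) (@Encodable.equivRangeEncode ℚ Rat.instEncodable) n
  rw [h]
  refine (congrArg Subtype.val
    ((@Encodable.equivRangeEncode ℚ Rat.instEncodable).apply_symm_apply _)).trans ?_
  exact congrArg Subtype.val (Denumerable.ofEquiv_ofNat ℕ _ n)

/-- The enumeration of an infinite computable set in increasing order is computable. -/
theorem computable_subtype_ofNat {s : Set ℕ} [Infinite s] [DecidablePred (· ∈ s)]
    (hs : ComputablePred (· ∈ s)) : Computable fun n => (Nat.Subtype.ofNat s n : ℕ) := by
  have hinf : s.Infinite := Set.infinite_coe_iff.1 inferInstance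
  have hex : ∀ x : ℕ, ∃ n, x + n + 1 ∈ s := fun x => by
    obtain ⟨m, hm, hxm⟩ := hinf.exists_gt x
    exact ⟨m - x - 1, by rwa [show x + (m - x - 1) + 1 = m by lia]⟩
  have hadd : Computable₂ ((· + ·) : ℕ → ℕ → ℕ) := Primrec.nat_add.to_comp
  have hpred : ComputablePred fun p : ℕ × ℕ => p.1 + p.2 + 1 ∈ s :=
    (hs.decide.comp (Computable.succ.comp
      (hadd.comp Computable.fst Computable.snd))).computablePred
  have hfind : Computable fun x => Nat.find (hex x) := Computable.find hpred hex
  have hnext : Computable fun x => x + Nat.find (hex x) + 1 :=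
    Computable.succ.comp (hadd.comp Computable.id hfind)
  have hrec := Computable.nat_rec (f := fun n : ℕ => n)
    (g := fun _ => ((⊥ : s) : ℕ)) (h := fun _ p => p.2 + Nat.find (hex p.2) + 1)
    Computable.id (Computable.const _)
    (hnext.comp (Computable.snd.comp Computable.snd))
  refine hrec.of_eq fun n => ?_
  induction n with
  | zero => rfl
  | succ n ih =>
    simp only [Nat.Subtype.ofNat, Nat.Subtype.succ]
    simp only [ih]

theorem mem_range_ratCode_iff (m : ℕ) : m ∈ Set.range ratCode ↔
    m.unpair.2 ≠ 0 ∧ ((m.unpair.1 + 1) / 2).Coprime m.unpair.2 := by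
  have key : ∀ z : ℤ, (Encodable.encode z + 1) / 2 = z.natAbs := by
    intro z
    cases z with
    | ofNat n => exact (by simp; lia : (2 * n + 1) / 2 = (Int.ofNat n).natAbs)
    | negSucc n => exact (by simp; lia : (2 * n + 1 + 1) / 2 = (Int.negSucc n).natAbs)
  constructor
  · rintro ⟨r, rfl⟩
    rw [ratCode_eq, Nat.unpair_pair, key]
    exact ⟨r.den_nz, r.reduced⟩
  · rintro ⟨h0, h1⟩
    have hz : Encodable.encode (Denumerable.ofNat ℤ m.unpair.1) = m.unpair.1 :=
      Denumerable.encode_ofNat _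
    refine ⟨⟨Denumerable.ofNat ℤ m.unpair.1, m.unpair.2, h0, ?_⟩, ?_⟩
    · rwa [← key, hz]
    · exact (congrArg (Nat.pair · _) hz).trans (Nat.pair_unpair m)

theorem primrecRel_coprime : PrimrecRel Nat.Coprime := by
  have h0 : PrimrecRel fun (x : ℕ) (p : ℕ × ℕ) => ¬ (p.1 % x = 0 ∧ p.2 % x = 0) ∨ x = 1 := by
    have hx : Primrec fun q : ℕ × ℕ × ℕ => q.1 := Primrec.fst
    have ha : Primrec fun q : ℕ × ℕ × ℕ => q.2.1 := Primrec.fst.comp Primrec.snd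
    have hb : Primrec fun q : ℕ × ℕ × ℕ => q.2.2 := Primrec.snd.comp Primrec.snd
    exact (((Primrec.eq.comp (Primrec.nat_mod.comp ha hx) (Primrec.const 0)).and
      (Primrec.eq.comp (Primrec.nat_mod.comp hb hx) (Primrec.const 0))).not.or
      (Primrec.eq.comp hx (Primrec.const 1)))
  have h1 : PrimrecPred fun p : ℕ × ℕ => ∀ x ∈ List.range (p.1 + p.2 + 2),
      ¬ (p.1 % x = 0 ∧ p.2 % x = 0) ∨ x = 1 :=
    h0.forall_mem_list.comp (Primrec.list_range.comp (Primrec.nat_add.comp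
      (Primrec.nat_add.comp Primrec.fst Primrec.snd) (Primrec.const 2))) Primrec.id
  refine PrimrecPred.of_eq h1 fun p => ?_
  obtain ⟨a, b⟩ := p
  simp only [List.mem_range, ← Nat.dvd_iff_mod_eq_zero]
  constructor
  · intro h
    rcases Nat.eq_zero_or_pos (a + b) with hab | hab
    · obtain ⟨rfl, rfl⟩ : a = 0 ∧ b = 0 := by lia
      have := h 0 (by lia)
      simp at this
    · have hle : a.gcd b ≤ a + b := by
        rcases Nat.eq_zero_or_pos a with rfl | ha
        · simp
        · exact (Nat.gcd_le_left b ha).trans (by lia)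
      exact (h (a.gcd b) (by lia)).resolve_left
        (not_not_intro ⟨Nat.gcd_dvd_left a b, Nat.gcd_dvd_right a b⟩)
  · intro h x _
    by_cases hx : x ∣ a ∧ x ∣ b
    · exact Or.inr (Nat.dvd_one.1 (h ▸ Nat.dvd_gcd hx.1 hx.2))
    · exact Or.inl hx

theorem computable_ratCode : Computable ratCode := by
  classical
  have h1 : Primrec fun m : ℕ => m.unpair.1 := Primrec.fst.comp Primrec.unpair
  have h2 : Primrec fun m : ℕ => m.unpair.2 := Primrec.snd.comp Primrec.unpair
  have hs : PrimrecPred (· ∈ Set.range ratCode) :=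
    PrimrecPred.of_eq ((Primrec.eq.comp h2 (Primrec.const 0)).not.and
      (primrecRel_coprime.comp
        (Primrec.nat_div.comp (Primrec.succ.comp h1) (Primrec.const 2)) h2))
      fun m => (mem_range_ratCode_iff m).symm
  refine ((computable_subtype_ofNat hs.computablePred).comp Computable.encode).of_eq fun r => ?_
  rw [← ratCode_ofNat, Denumerable.ofNat_encode]

theorem computablePred_inv_four_pow_lt :
    ComputablePred fun p : ℚ × ℕ => ((4 : ℚ) ^ p.2)⁻¹ < p.1 := by
  have hpow : Primrec fun n : ℕ => 4 ^ n :=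
    Primrec.nat_iff.2 ((Nat.Primrec.pow.comp ((Nat.Primrec.const 4).pair Nat.Primrec.id)).of_eq
      fun n => by simp)
  have h : PrimrecPred fun p : ℕ × ℕ => p.1.unpair.1.bodd = false ∧
      p.1.unpair.2 < p.1.unpair.1.div2 * 4 ^ p.2 := by
    have h1 : Primrec fun p : ℕ × ℕ => p.1.unpair.1 :=
      Primrec.fst.comp (Primrec.unpair.comp Primrec.fst)
    have h2 : Primrec fun p : ℕ × ℕ => p.1.unpair.2 :=
      Primrec.snd.comp (Primrec.unpair.comp Primrec.fst)
    exact (Primrec.eq.comp (Primrec.nat_bodd.comp h1) (Primrec.const false)).and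
      (Primrec.nat_lt.comp h2
        (Primrec.nat_mul.comp (Primrec.nat_div2.comp h1) (hpow.comp Primrec.snd)))
  obtain ⟨_, hc⟩ := h.computablePred
  refine ComputablePred.of_eq (hc.comp
    ((computable_ratCode.comp Computable.fst).pair Computable.snd)).computablePred ?_
  rintro ⟨r, L⟩
  have h4 : (0 : ℚ) < 4 ^ L := by positivity
  have hd : (0 : ℚ) < r.den := by exact_mod_cast r.den_pos
  have hlt : ((4 : ℚ) ^ L)⁻¹ < r ↔ (r.den : ℤ) < r.num * 4 ^ L := by
    conv_lhs => rw [← Rat.num_div_den r, inv_lt_iff_one_lt_mul₀ h4, div_mul_eq_mul_div,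
      one_lt_div hd]
    exact_mod_cast Iff.rfl
  simp only [ratCode_eq, Nat.unpair_pair]
  rw [hlt]
  generalize r.num = z
  cases z with
  | ofNat n =>
    rw [show Encodable.encode (Int.ofNat n) = 2 * n from rfl]
    simp
    norm_cast
  | negSucc n =>
    rw [show Encodable.encode (Int.negSucc n) = 2 * n + 1 from rfl]
    simp
    have : (Int.negSucc n) * 4 ^ L ≤ 0 :=
      mul_nonpos_of_nonpos_of_nonneg (Int.negSucc_lt_zero n).le (by positivity)
    lia

theorem length_wpre {k : ℕ} (x : ℕ → Fin k) (n : ℕ) : (wpre x n).length = n := by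
  simp [wpre]

theorem wpre_succ {k : ℕ} (x : ℕ → Fin k) (n : ℕ) : wpre x (n + 1) = wpre x n ++ [x n] := by
  simp only [wpre, List.ofFn_succ_last]
  rfl

/-- A recursively enumerable set of words that contains the empty word, and with each word some
one-letter extension of it, has a computable infinite branch. -/
theorem exists_computable_branch {k : ℕ} {P : List (Fin k) → ℕ → Prop}
    (hP : ComputablePred fun p : List (Fin k) × ℕ => P p.1 p.2) (hnil : ∃ L, P [] L)
    (hext : ∀ v, (∃ L, P v L) → ∃ a, ∃ L, P (v ++ [a]) L) :
    ∃ y : ℕ → Fin k, Computable y ∧ ∀ n, ∃ L, P (wpre y n) L := by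
  classical
  let c : List (Fin k) → Fin k × ℕ → Option (Fin k) :=
    fun v p => if P (v ++ [p.1]) p.2 then some p.1 else none
  have hc : Computable₂ c := by
    have h1 : Computable fun q : List (Fin k) × Fin k × ℕ => decide (P (q.1 ++ [q.2.1]) q.2.2) :=
      hP.decide.comp ((Computable.list_concat.comp Computable.fst
        (Computable.fst.comp Computable.snd)).pair (Computable.snd.comp Computable.snd))
    refine (Computable.cond h1 (Computable.option_some.comp (Computable.fst.comp Computable.snd))
      (Computable.const none)).of_eq fun q => ?_
    by_cases h : P (q.1 ++ [q.2.1]) q.2.2 <;> simp [c, h]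
  let s : List (Fin k) → ℕ → Option (Fin k) :=
    fun v m => (Encodable.decode (α := Fin k × ℕ) m).bind (c v)
  have hs : Computable₂ s :=
    Computable.option_bind (Computable.decode.comp Computable.snd)
      (hc.comp (Computable.fst.comp Computable.fst) Computable.snd)
  have hdom : ∀ v, (∃ L, P v L) → ∃ a ∈ Nat.rfindOpt (s v), ∃ L, P (v ++ [a]) L := by
    intro v hv
    obtain ⟨a, L, h⟩ := hext v hv
    have hd : (Nat.rfindOpt (s v)).Dom :=
      Nat.rfindOpt_dom.2 ⟨Encodable.encode (a, L), a, by simp [s, c, h]⟩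
    refine ⟨_, Part.get_mem hd, ?_⟩
    obtain ⟨n, hn⟩ := Nat.rfindOpt_spec (Part.get_mem hd)
    obtain ⟨p, -, hp⟩ := Option.bind_eq_some_iff.1 hn
    have hif : P (v ++ [p.1]) p.2 := by
      by_contra hne
      simp [c, hne] at hp
    rw [show c v p = some p.1 from if_pos hif] at hp
    exact ⟨p.2, Option.some_inj.1 hp ▸ hif⟩
  have : Nonempty (Fin k) := ⟨(hext [] hnil).choose⟩
  choose! g hg hgood using hdom
  let V : ℕ → List (Fin k) := fun n => n.rec [] fun _ v => v ++ [g v]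
  have hV : ∀ n, ∃ L, P (V n) L := fun n => by
    induction n with
    | zero => exact hnil
    | succ n ih => exact hgood _ ih
  have hstep : Partrec fun v => (Nat.rfindOpt (s v)).map fun a => v ++ [a] :=
    (Partrec.rfindOpt hs).map Computable.list_concat
  have hVc : Computable V := by
    refine (Partrec.nat_rec (f := fun n : ℕ => n) (g := fun _ => Part.some [])
      (h := fun _ p => (Nat.rfindOpt (s p.2)).map fun a => p.2 ++ [a])
      Computable.id (Computable.const _)
      (hstep.comp (Computable.snd.comp Computable.snd))).of_eq_tot fun n => ?_
    induction n with
    | zero => exact Part.mem_some _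
    | succ n ih =>
      exact Part.mem_bind_iff.2 ⟨V n, ih, Part.mem_map_iff _ |>.2 ⟨g (V n), hg _ (hV n), rfl⟩⟩
  have hy : ∀ n, wpre (fun m => g (V m)) n = V n := fun n => by
    induction n with
    | zero => rfl
    | succ n ih => rw [wpre_succ, ih]
  refine ⟨fun m => g (V m), ?_, fun n => hy n ▸ hV n⟩
  exact Partrec.of_eq_tot ((Partrec.rfindOpt hs).comp hVc) fun n => hg _ (hV n)

theorem mem_of_isClosed_of_forall_nonempty_inter_cyl {k : ℕ} {F : Set (ℕ → Fin k)}
    (hF : IsClosed F) {y : ℕ → Fin k} (h : ∀ n, (F ∩ cyl (wpre y n)).Nonempty) : y ∈ F := by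
  choose z hzF hz using h
  refine hF.mem_of_tendsto (f := z) (b := atTop) ?_ (Eventually.of_forall hzF)
  refine tendsto_pi_nhds.2 fun i => tendsto_const_nhds.congr' ?_
  filter_upwards [eventually_gt_atTop i] with n hn
  have h : wpre (z n) (wpre y n).length = wpre y n := hz n
  rw [length_wpre] at h
  exact (congrFun (List.ofFn_injective (n := n) h) ⟨i, hn⟩).symm

theorem cyl_subset_iUnion_cyl_append {k : ℕ} (v : List (Fin k)) :
    cyl v ⊆ ⋃ a, cyl (v ++ [a]) := by
  intro x hx
  refine Set.mem_iUnion.2 ⟨x v.length, ?_⟩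
  have hx : wpre x v.length = v := hx
  simp only [cyl, Set.mem_ofPred_eq, List.length_append, List.length_singleton, wpre_succ, hx]

theorem measure_iUnion_compl_le {Ω : Type*} [MeasurableSpace Ω] {ν : Measure Ω}
    [IsProbabilityMeasure ν] {G : ℕ → Set Ω} (hG : ∀ t, 1 ≤ t → MeasurableSet (G t))
    (hmeas : ∀ t, 1 ≤ t → 1 - ν (G t) ≤ ((2 : ℝ≥0∞) ^ (2 * t))⁻¹) (L : ℕ) :
    ν (⋃ t, (G (L + t + 1))ᶜ) ≤ ((4 : ℝ≥0∞) ^ L)⁻¹ * 3⁻¹ := by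
  calc ν (⋃ t, (G (L + t + 1))ᶜ) ≤ ∑' t, ν (G (L + t + 1))ᶜ := measure_iUnion_le _
    _ ≤ ∑' t : ℕ, ((4 : ℝ≥0∞) ^ L)⁻¹ * (4⁻¹ ^ (t + 1)) := by
      refine ENNReal.tsum_le_tsum fun t => ?_
      rw [prob_compl_eq_one_sub (hG _ (by lia))]
      refine (hmeas _ (by lia)).trans ?_
      rw [pow_mul, show (2 : ℝ≥0∞) ^ 2 = 4 by norm_num]
      simp only [ENNReal.inv_pow, ← pow_add, add_assoc, le_refl]
    _ = ((4 : ℝ≥0∞) ^ L)⁻¹ * 3⁻¹ := by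
      rw [ENNReal.tsum_mul_left, ENNReal.tsum_geometric_add_one]
      congr 1
      rw [← ENNReal.mul_inv (by simp) (by simp), ENNReal.mul_sub (by simp),
        ENNReal.mul_inv_cancel (by simp) (by simp), mul_one]
      congr 1
      exact ENNReal.sub_eq_of_eq_add (by simp) (by norm_num)

/-- effective extraction of a computable point from a uniformly
computable sequence of high-measure clopen sets. -/
theorem stmt_14 (k : ℕ) (hk : 2 ≤ k)
    (ν : Measure (ℕ → Fin k)) (hν : IsUniformProductMeasure ν)
    (G : ℕ → Set (ℕ → Fin k)) (hclopen : ∀ t : ℕ, 1 ≤ t → IsClopen (G t))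
    (hmeas : ∀ t : ℕ, 1 ≤ t → 1 - ν (G t) ≤ ((2 : ℝ≥0∞) ^ (2 * t))⁻¹)
    (q : ℕ → List (Fin k) → ℚ) (hq : Computable₂ q)
    (hq' : ∀ (L : ℕ) (v : List (Fin k)),
      ν ((⋂ t ∈ Finset.Icc 1 L, G t) ∩ cyl v) = ENNReal.ofReal ((q L v : ℝ))) :
    ∃ y : ℕ → Fin k, Computable y ∧ ∀ t : ℕ, 1 ≤ t → y ∈ G t := by
  have hprob : IsProbabilityMeasure ν := hν.1
  have hbad := measure_iUnion_compl_le (fun t ht => (hclopen t ht).isOpen.measurableSet) hmeas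
  set A : Set (ℕ → Fin k) := ⋂ t, G (t + 1)
  have hsub : ∀ L, A ⊆ ⋂ t ∈ Finset.Icc 1 L, G t := fun L x hx => by
    simp only [Set.mem_iInter, Finset.mem_Icc]
    rintro t ⟨ht, -⟩
    simpa [Nat.sub_add_cancel ht] using Set.mem_iInter.1 hx (t - 1)
  have hcover : ∀ L, (⋂ t ∈ Finset.Icc 1 L, G t) ⊆ A ∪ ⋃ t, (G (L + t + 1))ᶜ := by
    intro L x hx
    by_contra hne
    simp only [Set.mem_union, Set.mem_iUnion, Set.mem_compl_iff, not_or, not_exists,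
      not_not] at hne
    refine hne.1 (Set.mem_iInter.2 fun t => ?_)
    rcases Nat.lt_or_ge t L with htL | htL
    · exact Set.mem_iInter₂.1 hx (t + 1) (Finset.mem_Icc.2 ⟨by lia, by lia⟩)
    · simpa [Nat.add_sub_cancel' htL] using hne.2 (t - L)
  have hcast : ∀ L v, ((4 : ℚ) ^ L)⁻¹ < q L v ↔
      ((4 : ℝ≥0∞) ^ L)⁻¹ < ν ((⋂ t ∈ Finset.Icc 1 L, G t) ∩ cyl v) := by
    intro L v
    have h4 : ((4 : ℝ≥0∞) ^ L)⁻¹ = ENNReal.ofReal (((4 : ℚ) ^ L)⁻¹ : ℚ) := by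
      push_cast
      rw [ENNReal.ofReal_inv_of_pos (by positivity), ENNReal.ofReal_pow (by norm_num)]
      norm_num
    rw [hq', h4, ENNReal.ofReal_lt_ofReal_iff_of_nonneg (by positivity), Rat.cast_lt]
  have hpos : ∀ v, (∃ L, ((4 : ℚ) ^ L)⁻¹ < q L v) ↔ 0 < ν (A ∩ cyl v) := by
    intro v
    constructor
    · rintro ⟨L, hL⟩
      rw [hcast] at hL
      by_contra hzero
      have hzero : ν (A ∩ cyl v) = 0 := by simpa using hzero
      refine hL.not_ge ?_
      calc ν ((⋂ t ∈ Finset.Icc 1 L, G t) ∩ cyl v)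
          ≤ ν (A ∩ cyl v ∪ ⋃ t, (G (L + t + 1))ᶜ) := by
            refine measure_mono fun x hx => ?_
            exact (hcover L hx.1).imp (fun h => ⟨h, hx.2⟩) id
        _ ≤ ν (A ∩ cyl v) + ν (⋃ t, (G (L + t + 1))ᶜ) := measure_union_le _ _
        _ ≤ ((4 : ℝ≥0∞) ^ L)⁻¹ * 3⁻¹ := by rw [hzero, zero_add]; exact hbad L
        _ ≤ ((4 : ℝ≥0∞) ^ L)⁻¹ := mul_le_of_le_one_right' (by simp)
    · intro h
      obtain ⟨L, hL⟩ := ENNReal.exists_inv_nat_lt h.ne'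
      refine ⟨L, (hcast L v).2 (lt_of_lt_of_le (lt_of_le_of_lt ?_ hL)
        (measure_mono (Set.inter_subset_inter_left _ (hsub L))))⟩
      exact ENNReal.inv_le_inv.2 (by exact_mod_cast (Nat.lt_pow_self (by norm_num)).le)
  have hnil : 0 < ν (A ∩ cyl []) := by
    by_contra hzero
    have hzero : ν (A ∩ cyl []) = 0 := by simpa using hzero
    have huniv : (Set.univ : Set (ℕ → Fin k)) ⊆ A ∩ cyl [] ∪ ⋃ t, (G (0 + t + 1))ᶜ :=
      fun x _ => (hcover 0 (by simp)).imp (fun h => ⟨h, rfl⟩) id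
    have h1 : (1 : ℝ≥0∞) ≤ 3⁻¹ := by
      calc (1 : ℝ≥0∞) = ν Set.univ := measure_univ.symm
        _ ≤ ν (A ∩ cyl []) + ν (⋃ t, (G (0 + t + 1))ᶜ) :=
          (measure_mono huniv).trans (measure_union_le _ _)
        _ ≤ 3⁻¹ := by rw [hzero, zero_add]; simpa using hbad 0
    norm_num [ENNReal.one_le_inv] at h1
  have hext : ∀ v, 0 < ν (A ∩ cyl v) → ∃ a, 0 < ν (A ∩ cyl (v ++ [a])) := by
    intro v hv
    by_contra! hall
    refine hv.ne' (measure_mono_null ?_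
      (measure_iUnion_null fun a => nonpos_iff_eq_zero.1 (hall a)))
    rw [← Set.inter_iUnion]
    exact Set.inter_subset_inter_right _ (cyl_subset_iUnion_cyl_append v)
  obtain ⟨_, hdec⟩ := computablePred_inv_four_pow_lt
  obtain ⟨y, hy, hyL⟩ := exists_computable_branch (P := fun v L => ((4 : ℚ) ^ L)⁻¹ < q L v)
    (hdec.comp ((hq.comp Computable.snd Computable.fst).pair Computable.snd)).computablePred
    ((hpos []).2 hnil) fun v hv => by
      obtain ⟨a, ha⟩ := hext v ((hpos v).1 hv)
      exact ⟨a, (hpos _).2 ha⟩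
  refine ⟨y, hy, fun t ht => ?_⟩
  refine mem_of_isClosed_of_forall_nonempty_inter_cyl (hclopen t ht).isClosed fun n => ?_
  obtain ⟨x, hxA, hx⟩ := nonempty_of_measure_ne_zero ((hpos _).1 (hyL n)).ne'
  exact ⟨x, Set.mem_iInter₂.1 (hsub t hxA) t (Finset.mem_Icc.2 ⟨ht, le_rfl⟩), hx⟩
end
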